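/- Let ι have decidable equality, let S = Π i : ι, X i be a product state space, and let (A, U) be a decision problem on S. If I ⊆ ι is a minimal sufficient coordinate set, then a coordinate set J ⊆ ι is sufficient if and only if I ⊆ J. In other words, the family of sufficient coordinate sets is the principal filter generated by the minimal sufficient set. -/

import Mathlib

/-- The optimizer map of a decision problem with utility `U`. -/
def Opt {A S : Type*} (U : A → S → ℝ) (s : S) : Set A :=
  {a | ∀ b, U b s ≤ U a s}

/-- A coordinate set `I` is sufficient if agreement on `I` forces equal optimizer sets. -/
def Sufficient {ι : Type*} {X : ι → Type*} {A : Type*}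
    (U : A → (∀ i, X i) → ℝ) (I : Set ι) : Prop :=
  ∀ s s' : ∀ i, X i, (∀ i ∈ I, s i = s' i) → Opt U s = Opt U s'

/-- A coordinate `i` is relevant if erasing it destroys sufficiency. -/
def Relevant {ι : Type*} {X : ι → Type*} {A : Type*}
    (U : A → (∀ i, X i) → ℝ) (i : ι) : Prop :=
  ¬ Sufficient U (Set.univ \ {i})

/-- Agreement on a larger coordinate set is a stronger hypothesis. -/
theorem Sufficient.mono {ι : Type*} {X : ι → Type*} {A : Type*}
    {U : A → (∀ i, X i) → ℝ} {I J : Set ι} (hI : Sufficient U I) (h : I ⊆ J) :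
    Sufficient U J :=
  fun s s' hs => hI s s' fun i hi => hs i (h hi)

open Classical in
/-- On a product space, sufficient sets are closed under intersection: two states agreeing on
`I ∩ J` are linked by the state that follows the first on `I` and the second elsewhere. -/
theorem Sufficient.inter {ι : Type*} {X : ι → Type*} {A : Type*}
    {U : A → (∀ i, X i) → ℝ} {I J : Set ι} (hI : Sufficient U I) (hJ : Sufficient U J) :
    Sufficient U (I ∩ J) := by
  intro s s' h
  refine (hI s (I.piecewise s s') fun i hi => ?_).trans (hJ _ s' fun i hi => ?_)
  · rw [Set.piecewise_eq_of_mem _ _ _ hi]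
  · by_cases hiI : i ∈ I
    · rw [Set.piecewise_eq_of_mem _ _ _ hiI, h i ⟨hiI, hi⟩]
    · rw [Set.piecewise_eq_of_notMem _ _ _ hiI]

/-- Sufficient sets form the principal filter generated by a minimal sufficient set. -/
theorem sufficient_principal_filter {ι : Type*} [DecidableEq ι] {X : ι → Type*} {A : Type*}
    (U : A → (∀ i, X i) → ℝ) (I : Set ι)
    (hI : Sufficient U I ∧ ∀ J : Set ι, J ⊂ I → ¬ Sufficient U J) :
    ∀ J : Set ι, Sufficient U J ↔ I ⊆ J := by
  refine fun J => ⟨fun hJ => ?_, hI.1.mono⟩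
  by_contra hIJ
  exact hI.2 (I ∩ J) (Set.inter_ssubset_left_iff.2 hIJ) (hI.1.inter hJ)
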